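/- Let p = 2/N for an integer N ≥ 1, and let A = (a(j,k))_{j,k∈ℤ^d} satisfy Σ_{j,k} |a(j,k)|^p < ∞. Then A, viewed as an operator on ℓ²(ℤ^d), belongs to the Schatten class I_p, with ‖A‖_{I_p} ≤ (Σ_{j,k} |a(j,k)|^p)^{1/p}. -/

import Mathlib

open scoped ENNReal

/-- The `n`-th singular value (0-indexed) of a bounded operator between Hilbert
spaces. -/
noncomputable def singVal {H₁ H₂ : Type*} [NormedAddCommGroup H₁]
    [InnerProductSpace ℂ H₁] [NormedAddCommGroup H₂] [InnerProductSpace ℂ H₂]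
    (T : H₁ →L[ℂ] H₂) (n : ℕ) : ℝ :=
  sInf {r : ℝ | ∃ T₀ : H₁ →L[ℂ] H₂,
    Module.rank ℂ (LinearMap.range T₀.toLinearMap) ≤ (n : Cardinal) ∧ ‖T - T₀‖ = r}

theorem summable_sq_and_tsum_sq_le {ι : Type*} {x : ι → ℝ} (hx : ∀ i, 0 ≤ x i) {p : ℝ}
    (hp0 : 0 < p) (hp2 : p ≤ 2) (h : Summable fun i => x i ^ p) :
    Summable (fun i => x i ^ 2) ∧ (∑' i, x i ^ 2) ^ (p / 2) ≤ ∑' i, x i ^ p := by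
  set S := ∑' i, x i ^ p with hS
  have hS0 : 0 ≤ S := tsum_nonneg fun i => Real.rpow_nonneg (hx i) p
  have hle : ∀ i, x i ^ 2 ≤ x i ^ p * S ^ ((2 - p) / p) := by
    intro i
    rcases (hx i).eq_or_lt with h0 | hpos
    · rw [← h0, Real.zero_rpow hp0.ne']; simp
    have h1 : x i ^ p ≤ S := h.le_tsum i fun j _ => Real.rpow_nonneg (hx j) p
    have h2 : x i ^ (2 - p) ≤ S ^ ((2 - p) / p) := by
      calc x i ^ (2 - p) = (x i ^ p) ^ ((2 - p) / p) := by
            rw [← Real.rpow_mul (hx i)]; congr 1; field_simp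
        _ ≤ _ := Real.rpow_le_rpow (Real.rpow_nonneg (hx i) p) h1
            (div_nonneg (by linarith) hp0.le)
    calc x i ^ 2 = x i ^ p * x i ^ (2 - p) := by
          rw [← Real.rpow_add hpos, ← Real.rpow_natCast]; congr 1; push_cast; ring
      _ ≤ _ := mul_le_mul_of_nonneg_left h2 (Real.rpow_nonneg (hx i) p)
  have hs : Summable (fun i => x i ^ 2) :=
    Summable.of_nonneg_of_le (fun i => sq_nonneg _) hle (h.mul_right _)
  refine ⟨hs, ?_⟩
  have h3 : ∑' i, x i ^ 2 ≤ S * S ^ ((2 - p) / p) := by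
    rw [hS, ← tsum_mul_right, ← hS]
    exact hs.tsum_le_tsum hle (h.mul_right _)
  rcases hS0.eq_or_lt with h0 | hpos
  · rw [← h0, zero_mul] at h3
    rw [← h0, le_antisymm h3 (tsum_nonneg fun i => sq_nonneg _), Real.zero_rpow (by positivity)]
  calc (∑' i, x i ^ 2) ^ (p / 2) ≤ (S * S ^ ((2 - p) / p)) ^ (p / 2) :=
        Real.rpow_le_rpow (tsum_nonneg fun i => sq_nonneg _) h3 (by positivity)
    _ = (S ^ (2 / p)) ^ (p / 2) := by
        congr 1
        rw [show 2 / p = 1 + (2 - p) / p by field_simp; ring, Real.rpow_add hpos, Real.rpow_one]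
    _ = S := by
        rw [← Real.rpow_mul hS0, show 2 / p * (p / 2) = 1 by field_simp, Real.rpow_one]

section SingularValues

variable {H₁ H₂ : Type*} [NormedAddCommGroup H₁] [InnerProductSpace ℂ H₁]
  [NormedAddCommGroup H₂] [InnerProductSpace ℂ H₂]

theorem singVal_le (T T₀ : H₁ →L[ℂ] H₂) (n : ℕ)
    (h : Module.rank ℂ (LinearMap.range T₀.toLinearMap) ≤ (n : Cardinal)) :
    singVal T n ≤ ‖T - T₀‖ :=
  csInf_le ⟨0, by rintro r ⟨_, _, rfl⟩; exact norm_nonneg _⟩ ⟨T₀, h, rfl⟩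

theorem le_singVal (T : H₁ →L[ℂ] H₂) (n : ℕ) {c : ℝ}
    (h : ∀ T₀ : H₁ →L[ℂ] H₂,
      Module.rank ℂ (LinearMap.range T₀.toLinearMap) ≤ (n : Cardinal) → c ≤ ‖T - T₀‖) :
    c ≤ singVal T n := by
  refine le_csInf ⟨‖T - 0‖, 0, ?_, rfl⟩ ?_
  · simp
  · rintro r ⟨T₀, hT₀, rfl⟩
    exact h T₀ hT₀

theorem singVal_nonneg (T : H₁ →L[ℂ] H₂) (n : ℕ) : 0 ≤ singVal T n :=
  le_singVal T n fun _ _ => norm_nonneg _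

theorem singVal_le_add (T S : H₁ →L[ℂ] H₂) (n : ℕ) :
    singVal T n ≤ singVal S n + ‖T - S‖ := by
  rw [← sub_le_iff_le_add]
  refine le_singVal S n fun S₀ hS₀ => ?_
  rw [sub_le_iff_le_add]
  calc singVal T n ≤ ‖T - S₀‖ := singVal_le T S₀ n hS₀
    _ = ‖(S - S₀) + (T - S)‖ := by congr 1; abel
    _ ≤ _ := norm_add_le _ _

theorem singVal_comp_le {H₀ : Type*} [NormedAddCommGroup H₀] [InnerProductSpace ℂ H₀]
    (T : H₁ →L[ℂ] H₂) (U : H₀ →L[ℂ] H₁) (hU : ‖U‖ ≤ 1) (n : ℕ) :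
    singVal (T ∘L U) n ≤ singVal T n := by
  refine le_singVal T n fun T₀ hT₀ => ?_
  calc singVal (T ∘L U) n ≤ ‖T ∘L U - T₀ ∘L U‖ := by
        refine singVal_le _ _ n (le_trans ?_ hT₀)
        exact Submodule.rank_mono (LinearMap.range_comp_le_range _ _)
    _ = ‖(T - T₀) ∘L U‖ := by rw [ContinuousLinearMap.sub_comp]
    _ ≤ ‖T - T₀‖ * ‖U‖ := ContinuousLinearMap.opNorm_comp_le _ _
    _ ≤ ‖T - T₀‖ := mul_le_of_le_one_right (norm_nonneg _) hU

open Filter Topology in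
theorem tendsto_singVal {α : Type*} {l : Filter α} {S : α → H₁ →L[ℂ] H₂} {T : H₁ →L[ℂ] H₂}
    (h : Tendsto (fun i => ‖T - S i‖) l (𝓝 0)) (n : ℕ) :
    Tendsto (fun i => singVal (S i) n) l (𝓝 (singVal T n)) := by
  rw [tendsto_iff_norm_sub_tendsto_zero]
  refine squeeze_zero (fun _ => norm_nonneg _) (fun i => ?_) h
  have h1 := singVal_le_add T (S i) n
  have h2 := singVal_le_add (S i) T n
  rw [norm_sub_rev (S i) T] at h2
  rw [Real.norm_eq_abs, abs_le]
  constructor <;> linarith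

theorem nonneg_of_norm_sq_eq_sum {m : ℕ} {T : H₁ →L[ℂ] H₂} {v : OrthonormalBasis (Fin m) ℂ H₁}
    {μ : Fin m → ℝ} (h : ∀ x, ‖T x‖ ^ 2 = ∑ i, μ i * ‖inner ℂ (v i) x‖ ^ 2) (i : Fin m) :
    0 ≤ μ i := by
  have hi : ‖T (v i)‖ ^ 2 = μ i := by
    rw [h, Finset.sum_eq_single i]
    · simp
    · intro j _ hj
      simp [v.orthonormal.2 hj]
    · simp
  exact hi ▸ sq_nonneg _

theorem singVal_le_sqrt {m : ℕ} (T : H₁ →L[ℂ] H₂) (v : OrthonormalBasis (Fin m) ℂ H₁)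
    {μ : Fin m → ℝ} (hμ : Antitone μ)
    (h : ∀ x, ‖T x‖ ^ 2 = ∑ i, μ i * ‖inner ℂ (v i) x‖ ^ 2) (n : Fin m) :
    singVal T n ≤ √(μ n) := by
  classical
  set P : H₁ →L[ℂ] H₁ := ∑ i with i < n, (innerSL ℂ (v i)).smulRight (v i)
  have hP : ∀ x, P x = ∑ i with i < n, inner ℂ (v i) x • v i := by
    intro x
    simp [P]
  have hinner : ∀ x i, inner ℂ (v i) (x - P x) = if i < n then 0 else inner ℂ (v i) x := by
    intro x i
    rw [inner_sub_right, hP, inner_sum]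
    simp only [inner_smul_right, orthonormal_iff_ite.1 v.orthonormal]
    by_cases hi : i < n <;> simp [hi, Finset.sum_ite_eq]
  refine (singVal_le T (T ∘L P) n ?_).trans ?_
  · have hle : LinearMap.range (T ∘L P).toLinearMap ≤
        Submodule.span ℂ (((Finset.univ.filter (· < n)).image fun i => T (v i) : Finset H₂) :
          Set H₂) := by
      rintro _ ⟨x, rfl⟩
      simp only [ContinuousLinearMap.coe_coe, ContinuousLinearMap.comp_apply]
      rw [hP, map_sum]
      refine Submodule.sum_mem _ fun i hi => ?_
      rw [map_smul]
      exact Submodule.smul_mem _ _ (Submodule.subset_span (Finset.mem_coe.2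
        (Finset.mem_image_of_mem _ hi)))
    refine (Submodule.rank_mono hle).trans ((rank_span_finset_le _).trans ?_)
    refine Nat.cast_le.2 (Finset.card_image_le.trans ?_)
    rw [show Finset.univ.filter (· < n) = Finset.Iio n by ext; simp, Fin.card_Iio]
  · refine ContinuousLinearMap.opNorm_le_bound _ (Real.sqrt_nonneg _) fun x => ?_
    have hx : (T - T ∘L P) x = T (x - P x) := by simp
    have hμn : 0 ≤ μ n := nonneg_of_norm_sq_eq_sum h n
    rw [hx]
    refine abs_le_of_sq_le_sq' ?_ (by positivity) |>.2
    rw [h, mul_pow, Real.sq_sqrt hμn, ← v.sum_sq_norm_inner_right x, Finset.mul_sum]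
    refine Finset.sum_le_sum fun i _ => ?_
    rw [hinner]
    split_ifs with hi
    · simp; positivity
    · exact mul_le_mul_of_nonneg_right (hμ (not_lt.1 hi)) (by positivity)

variable [CompleteSpace H₁] [CompleteSpace H₂]

/-- An orthonormal basis that diagonalizes `T† T`, with the eigenvalues in decreasing order. -/
theorem exists_antitone_orthonormalBasis [FiniteDimensional ℂ H₁] (T : H₁ →L[ℂ] H₂) :
    ∃ (v : OrthonormalBasis (Fin (Module.finrank ℂ H₁)) ℂ H₁)
      (μ : Fin (Module.finrank ℂ H₁) → ℝ), Antitone μ ∧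
      ∀ x, ‖T x‖ ^ 2 = ∑ i, μ i * ‖inner ℂ (v i) x‖ ^ 2 := by
  set S : H₁ →L[ℂ] H₁ := ContinuousLinearMap.adjoint T ∘L T
  have hS : (S : H₁ →ₗ[ℂ] H₁).IsSymmetric :=
    (ContinuousLinearMap.isPositive_adjoint_comp_self T).isSymmetric
  have key : ∀ x, ‖T x‖ ^ 2 =
      ∑ i, hS.eigenvalues rfl i * ‖inner ℂ (hS.eigenvectorBasis rfl i) x‖ ^ 2 := by
    intro x
    have h1 : inner ℂ x (S x) = ((‖T x‖ ^ 2 : ℝ) : ℂ) := by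
      rw [ContinuousLinearMap.comp_apply, ContinuousLinearMap.adjoint_inner_right,
        inner_self_eq_norm_sq_to_K]
      simp
    rw [← (hS.eigenvectorBasis rfl).sum_inner_mul_inner] at h1
    have h2 : ∀ i, inner ℂ (hS.eigenvectorBasis rfl i) (S x) =
        (hS.eigenvalues rfl i : ℂ) * inner ℂ (hS.eigenvectorBasis rfl i) x := by
      intro i
      have := hS (hS.eigenvectorBasis rfl i) x
      rw [hS.apply_eigenvectorBasis, inner_smul_left] at this
      simpa using this.symm
    have h3 : ((∑ i, hS.eigenvalues rfl i * ‖inner ℂ (hS.eigenvectorBasis rfl i) x‖ ^ 2 : ℝ) : ℂ)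
        = ((‖T x‖ ^ 2 : ℝ) : ℂ) := by
      rw [← h1]
      push_cast
      refine Finset.sum_congr rfl fun i _ => ?_
      rw [h2, ← inner_conj_symm x, ← Complex.conj_mul']
      ring
    exact_mod_cast h3.symm
  exact ⟨hS.eigenvectorBasis rfl, hS.eigenvalues rfl, hS.eigenvalues_antitone rfl, key⟩

theorem sum_singVal_rpow_le {ι : Type*} [Fintype ι] (T : H₁ →L[ℂ] H₂)
    (e : OrthonormalBasis ι ℂ H₁) {p : ℝ} (hp0 : 0 < p) (hp2 : p ≤ 2) (s : Finset ℕ) :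
    ∑ n ∈ s, singVal T n ^ p ≤ ∑ k, ‖T (e k)‖ ^ p := by
  classical
  have : FiniteDimensional ℂ H₁ := e.toBasis.finiteDimensional_of_finite
  obtain ⟨v, μ, hanti, hT⟩ := exists_antitone_orthonormalBasis T
  have hμ := nonneg_of_norm_sq_eq_sum hT
  have hzero : ∀ n, Module.finrank ℂ H₁ ≤ n → singVal T n = 0 := by
    intro n hn
    refine le_antisymm ?_ (singVal_nonneg T n)
    have := singVal_le T T n (by
      rw [← Module.finrank_eq_rank]
      exact_mod_cast (LinearMap.finrank_range_le _).trans hn)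
    simpa using this
  have h1 : ∑ n ∈ s, singVal T n ^ p ≤ ∑ i, μ i ^ (p / 2) := by
    calc ∑ n ∈ s, singVal T n ^ p ≤ ∑ n ∈ Finset.range (Module.finrank ℂ H₁), singVal T n ^ p := by
          rw [← Finset.sum_subset (Finset.inter_subset_left (s₁ := s)
            (s₂ := Finset.range (Module.finrank ℂ H₁)))]
          · exact Finset.sum_le_sum_of_subset_of_nonneg Finset.inter_subset_right
              fun n _ _ => Real.rpow_nonneg (singVal_nonneg T n) p
          · intro n hn hn'
            have hle : Module.finrank ℂ H₁ ≤ n := by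
              by_contra hc
              exact hn' (Finset.mem_inter.2 ⟨hn, Finset.mem_range.2 (not_le.1 hc)⟩)
            rw [hzero n hle, Real.zero_rpow hp0.ne']
      _ = ∑ i : Fin _, singVal T i ^ p := Finset.sum_range _
      _ ≤ _ := by
          refine Finset.sum_le_sum fun i _ => ?_
          calc singVal T i ^ p ≤ √(μ i) ^ p :=
                Real.rpow_le_rpow (singVal_nonneg T i) (singVal_le_sqrt T v hanti hT i) hp0.le
            _ = _ := by
                rw [Real.sqrt_eq_rpow, ← Real.rpow_mul (hμ i)]; congr 1; ring
  refine h1.trans ?_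
  have h2 : ∀ k, ∑ i, ‖inner ℂ (v i) (e k)‖ ^ 2 * μ i ^ (p / 2) ≤ ‖T (e k)‖ ^ p := by
    intro k
    have hw : ∑ i, ‖inner ℂ (v i) (e k)‖ ^ 2 = 1 := by
      rw [v.sum_sq_norm_inner_right, e.orthonormal.1 k, one_pow]
    have hJ := (Real.concaveOn_rpow (p := p / 2) (by positivity) (by linarith)).le_map_sum
      (t := Finset.univ) (w := fun i => ‖inner ℂ (v i) (e k)‖ ^ 2) (p := μ)
      (fun i _ => by positivity) hw (fun i _ => hμ i)
    simp only [smul_eq_mul] at hJ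
    refine hJ.trans_eq ?_
    rw [show ∑ i, ‖inner ℂ (v i) (e k)‖ ^ 2 * μ i = ‖T (e k)‖ ^ 2 by
      rw [hT]; exact Finset.sum_congr rfl fun i _ => mul_comm _ _]
    rw [← Real.rpow_natCast, ← Real.rpow_mul (norm_nonneg _)]
    congr 1
    push_cast
    ring
  calc ∑ i, μ i ^ (p / 2) = ∑ i, ∑ k, ‖inner ℂ (v i) (e k)‖ ^ 2 * μ i ^ (p / 2) := by
        refine Finset.sum_congr rfl fun i _ => ?_
        rw [← Finset.sum_mul, e.sum_sq_norm_inner_left, v.orthonormal.1 i]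
        simp
    _ = ∑ k, ∑ i, ‖inner ℂ (v i) (e k)‖ ^ 2 * μ i ^ (p / 2) := Finset.sum_comm
    _ ≤ _ := Finset.sum_le_sum fun k _ => h2 k

end SingularValues

section MatrixOperator

variable {ι κ : Type*}

theorem lp_two_hasSum_norm_sq (f : lp (fun _ : ι => ℂ) 2) :
    HasSum (fun i => ‖f i‖ ^ 2) (‖f‖ ^ 2) := by
  have := lp.hasSum_norm (p := 2) (by norm_num) f
  simpa using this

theorem memℓp_two_of_summable_sq {f : ι → ℂ} (hf : Summable fun i => ‖f i‖ ^ 2) :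
    Memℓp f 2 :=
  memℓp_gen (by simpa using hf)

theorem exists_clm_of_summable_norm_sq (b : ι → κ → ℂ)
    (hb : Summable fun jk : ι × κ => ‖b jk.1 jk.2‖ ^ 2) :
    ∃ T : lp (fun _ : κ => ℂ) 2 →L[ℂ] lp (fun _ : ι => ℂ) 2,
      (∀ f j, T f j = ∑' k, b j k * f k) ∧ ‖T‖ ^ 2 ≤ ∑' jk : ι × κ, ‖b jk.1 jk.2‖ ^ 2 := by
  have hrow : ∀ j, Summable fun k => ‖star (b j k)‖ ^ 2 := fun j => by
    simpa using hb.prod_factor j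
  let w : ι → lp (fun _ : κ => ℂ) 2 := fun j =>
    ⟨fun k => star (b j k), memℓp_two_of_summable_sq (hrow j)⟩
  have hw : ∀ j (f : lp (fun _ : κ => ℂ) 2), inner ℂ (w j) f = ∑' k, b j k * f k := by
    intro j f
    rw [lp.inner_eq_tsum]
    refine tsum_congr fun k => ?_
    simp [w, mul_comm]
  have hwn : ∀ j, ‖w j‖ ^ 2 = ∑' k, ‖b j k‖ ^ 2 := by
    intro j
    rw [← (lp_two_hasSum_norm_sq (w j)).tsum_eq]
    refine tsum_congr fun k => ?_
    simp [w]
  have hws : Summable fun j => ‖w j‖ ^ 2 := by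
    simp only [hwn]
    exact hb.prod
  have hwt : ∑' j, ‖w j‖ ^ 2 = ∑' jk : ι × κ, ‖b jk.1 jk.2‖ ^ 2 := by
    simp only [hwn]
    exact hb.tsum_prod.symm
  set C := ∑' jk : ι × κ, ‖b jk.1 jk.2‖ ^ 2
  have hC : 0 ≤ C := tsum_nonneg fun _ => sq_nonneg _
  have hle : ∀ f j, ‖inner ℂ (w j) f‖ ^ 2 ≤ ‖w j‖ ^ 2 * ‖f‖ ^ 2 := fun f j => by
    rw [← mul_pow]
    exact pow_le_pow_left₀ (norm_nonneg _) (norm_inner_le_norm _ _) 2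
  have hsum : ∀ f, Summable fun j => ‖inner ℂ (w j) f‖ ^ 2 := fun f =>
    Summable.of_nonneg_of_le (fun _ => sq_nonneg _) (hle f) (hws.mul_right _)
  let L : lp (fun _ : κ => ℂ) 2 →ₗ[ℂ] lp (fun _ : ι => ℂ) 2 :=
    { toFun := fun f => ⟨fun j => inner ℂ (w j) f, memℓp_two_of_summable_sq (hsum f)⟩
      map_add' := fun f g => by ext j; exact inner_add_right _ _ _
      map_smul' := fun c f => by ext j; exact inner_smul_right _ _ _ }
  have hL : ∀ f, ‖L f‖ ≤ √C * ‖f‖ := by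
    intro f
    refine abs_le_of_sq_le_sq' ?_ (by positivity) |>.2
    rw [mul_pow, Real.sq_sqrt hC, ← hwt, ← (lp_two_hasSum_norm_sq (L f)).tsum_eq,
      ← tsum_mul_right]
    exact (hsum f).tsum_le_tsum (hle f) (hws.mul_right _)
  refine ⟨L.mkContinuous (√C) hL, fun f j => hw j f, ?_⟩
  calc ‖L.mkContinuous (√C) hL‖ ^ 2 ≤ √C ^ 2 :=
        pow_le_pow_left₀ (norm_nonneg _) (L.mkContinuous_norm_le (Real.sqrt_nonneg _) hL) 2
    _ = C := Real.sq_sqrt hC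

/-- Restriction of a square-summable family to finitely many coordinates. -/
noncomputable def lpRestrict (s : Finset κ) :
    lp (fun _ : κ => ℂ) 2 →L[ℂ] EuclideanSpace ℂ s :=
  LinearMap.mkContinuous
    { toFun := fun f => WithLp.toLp 2 fun k : s => f k
      map_add' := fun f g => by ext k; simp
      map_smul' := fun c f => by ext k; simp } 1 (fun f => by
    refine abs_le_of_sq_le_sq' ?_ (by positivity) |>.2
    rw [one_mul, EuclideanSpace.norm_sq_eq]
    refine le_trans (le_of_eq ?_)
      (sum_le_hasSum s (fun _ _ => sq_nonneg _) (lp_two_hasSum_norm_sq f))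
    exact Finset.sum_coe_sort s fun k => ‖f k‖ ^ 2)

theorem norm_lpRestrict_le (s : Finset κ) : ‖lpRestrict s‖ ≤ 1 :=
  LinearMap.mkContinuous_norm_le _ zero_le_one _

@[simp]
theorem lpRestrict_apply (s : Finset κ) (f : lp (fun _ : κ => ℂ) 2) (k : s) :
    lpRestrict s f k = f k := rfl

open Classical in
/-- Extension of a finite family by zero. -/
noncomputable def lpExtend (s : Finset κ) :
    EuclideanSpace ℂ s →L[ℂ] lp (fun _ : κ => ℂ) 2 :=
  ∑ k : s, (EuclideanSpace.proj k : EuclideanSpace ℂ s →L[ℂ] ℂ).smulRight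
    (lp.single 2 (k : κ) (1 : ℂ))

open Classical in
theorem lpExtend_apply (s : Finset κ) (x : EuclideanSpace ℂ s) (k : κ) :
    lpExtend s x k = if h : k ∈ s then x ⟨k, h⟩ else 0 := by
  have h1 : lpExtend s x = ∑ i : s, x i • lp.single 2 (i : κ) (1 : ℂ) := by
    simp [lpExtend]
  rw [h1, lp.coeFn_sum, Finset.sum_apply]
  simp only [lp.coeFn_smul, Pi.smul_apply, lp.single_apply, smul_eq_mul]
  split_ifs with h
  · rw [Finset.sum_eq_single ⟨k, h⟩]
    · simp
    · intro i _ hi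
      have : k ≠ i := fun hc => hi (Subtype.ext hc.symm)
      simp [Pi.single_eq_of_ne this]
    · simp
  · refine Finset.sum_eq_zero fun i _ => ?_
    have : k ≠ i := fun hc => h (hc ▸ i.2)
    simp [Pi.single_eq_of_ne this]

open Filter Topology in
theorem tendsto_norm_sub_truncation {b : ι → κ → ℂ}
    (hb : Summable fun jk : ι × κ => ‖b jk.1 jk.2‖ ^ 2)
    {T : lp (fun _ : κ => ℂ) 2 →L[ℂ] lp (fun _ : ι => ℂ) 2}
    (hT : ∀ f j, T f j = ∑' k, b j k * f k) :
    Tendsto (fun s : Finset κ => ‖T - (T ∘L lpExtend s) ∘L lpRestrict s‖) atTop (𝓝 0) := by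
  classical
  have hlim : Tendsto (fun s : Finset κ => ∑' jk : ι × κ,
      ‖if jk.2 ∈ s then 0 else b jk.1 jk.2‖ ^ 2) atTop (𝓝 (∑' _ : ι × κ, (0 : ℝ))) := by
    refine tendsto_tsum_of_dominated_convergence hb (fun jk => ?_) (Eventually.of_forall ?_)
    · refine tendsto_const_nhds.congr' ?_
      filter_upwards [eventually_ge_atTop {jk.2}] with s hs
      simp [hs (Finset.mem_singleton_self jk.2)]
    · intro s jk
      split_ifs <;> simp
  have hle : ∀ s : Finset κ, ‖T - (T ∘L lpExtend s) ∘L lpRestrict s‖ ≤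
      √(∑' jk : ι × κ, ‖if jk.2 ∈ s then 0 else b jk.1 jk.2‖ ^ 2) := by
    intro s
    obtain ⟨R, hR, hRn⟩ := exists_clm_of_summable_norm_sq
      (fun j k => if k ∈ s then 0 else b j k)
      (Summable.of_nonneg_of_le (fun _ => sq_nonneg _)
        (fun jk => by split_ifs <;> simp) hb)
    have : T - (T ∘L lpExtend s) ∘L lpRestrict s = R := by
      ext f j
      have h1 : (T - (T ∘L lpExtend s) ∘L lpRestrict s) f =
          T (f - lpExtend s (lpRestrict s f)) := by simp
      rw [h1, hT, hR]
      refine tsum_congr fun k => ?_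
      rw [lp.coeFn_sub, Pi.sub_apply, lpExtend_apply]
      split_ifs <;> simp
    rw [this]
    exact Real.le_sqrt_of_sq_le hRn
  refine squeeze_zero (fun _ => norm_nonneg _) hle ?_
  simpa using hlim.sqrt

theorem summable_singVal_rpow_and_tsum_le {b : ι → κ → ℂ} {p : ℝ} (hp0 : 0 < p) (hp2 : p ≤ 2)
    (hb : Summable fun jk : ι × κ => ‖b jk.1 jk.2‖ ^ p)
    {T : lp (fun _ : κ => ℂ) 2 →L[ℂ] lp (fun _ : ι => ℂ) 2}
    (hT : ∀ f j, T f j = ∑' k, b j k * f k) :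
    Summable (fun n => singVal T n ^ p) ∧
      ∑' n, singVal T n ^ p ≤ ∑' jk : ι × κ, ‖b jk.1 jk.2‖ ^ p := by
  classical
  have hb' : Summable fun kj : κ × ι => ‖b kj.2 kj.1‖ ^ p := hb.prod_symm
  have hcol : ∀ (s : Finset κ) (k : s),
      ‖(T ∘L lpExtend s) (EuclideanSpace.basisFun s ℂ k)‖ ^ p ≤ ∑' j, ‖b j k‖ ^ p := by
    intro s k
    set g := (T ∘L lpExtend s) (EuclideanSpace.basisFun s ℂ k)
    have hg : ∀ j, g j = b j k := by
      intro j
      simp only [g, ContinuousLinearMap.comp_apply, hT, lpExtend_apply]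
      rw [tsum_eq_single (k : κ)]
      · simp
      · intro i hi
        split_ifs with h
        · have : (⟨i, h⟩ : s) ≠ k := fun hc => hi (congrArg Subtype.val hc)
          simp [this]
        · simp
    have h1 := (summable_sq_and_tsum_sq_le (fun j => norm_nonneg (b j k)) hp0 hp2
      (hb'.prod_factor (k : κ))).2
    refine le_trans (le_of_eq ?_) h1
    have h2 : ∑' j, ‖b j k‖ ^ 2 = ‖g‖ ^ 2 := by
      rw [← (lp_two_hasSum_norm_sq g).tsum_eq]
      simp only [hg]
    rw [h2, ← Real.rpow_natCast, ← Real.rpow_mul (norm_nonneg _)]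
    congr 1
    push_cast
    ring
  have htrunc : ∀ (s : Finset κ) (t : Finset ℕ),
      ∑ n ∈ t, singVal ((T ∘L lpExtend s) ∘L lpRestrict s) n ^ p ≤
        ∑' jk : ι × κ, ‖b jk.1 jk.2‖ ^ p := by
    intro s t
    calc ∑ n ∈ t, singVal ((T ∘L lpExtend s) ∘L lpRestrict s) n ^ p
        ≤ ∑ n ∈ t, singVal (T ∘L lpExtend s) n ^ p :=
          Finset.sum_le_sum fun n _ => Real.rpow_le_rpow (singVal_nonneg _ n)
            (singVal_comp_le _ _ (norm_lpRestrict_le s) n) hp0.le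
      _ ≤ ∑ k : s, ‖(T ∘L lpExtend s) (EuclideanSpace.basisFun s ℂ k)‖ ^ p :=
          sum_singVal_rpow_le _ _ hp0 hp2 t
      _ ≤ ∑ k : s, ∑' j, ‖b j k‖ ^ p := Finset.sum_le_sum fun k _ => hcol s k
      _ = ∑ k ∈ s, ∑' j, ‖b j k‖ ^ p := Finset.sum_coe_sort s fun k => ∑' j, ‖b j k‖ ^ p
      _ ≤ ∑' k, ∑' j, ‖b j k‖ ^ p :=
          hb'.prod.sum_le_tsum s fun k _ => tsum_nonneg fun j => by positivity
      _ = ∑' kj : κ × ι, ‖b kj.2 kj.1‖ ^ p := hb'.tsum_prod.symm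
      _ = _ := (Equiv.prodComm κ ι).tsum_eq fun jk : ι × κ => ‖b jk.1 jk.2‖ ^ p
  have hb2 := (summable_sq_and_tsum_sq_le (fun jk : ι × κ => norm_nonneg (b jk.1 jk.2))
    hp0 hp2 hb).1
  have hfin : ∀ t : Finset ℕ,
      ∑ n ∈ t, singVal T n ^ p ≤ ∑' jk : ι × κ, ‖b jk.1 jk.2‖ ^ p := fun t =>
    le_of_tendsto (tendsto_finsetSum t fun n _ =>
      (tendsto_singVal (tendsto_norm_sub_truncation hb2 hT) n).rpow_const (Or.inr hp0.le))
      (Filter.Eventually.of_forall fun s => htrunc s t)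
  have hnn : ∀ n, 0 ≤ singVal T n ^ p := fun n => Real.rpow_nonneg (singVal_nonneg T n) p
  exact ⟨summable_of_sum_le hnn hfin, Real.tsum_le_of_sum_le hnn hfin⟩

end MatrixOperator

/-- for `p = 2/N` with `N ≥ 1` an integer, a matrix with
`Σ_{j,k} |a(j,k)|^p < ∞` defines an operator on `ℓ²(ℤ^d)` of Schatten class `I_p`,
with `‖A‖_{I_p} ≤ (Σ_{j,k} |a(j,k)|^p)^{1/p}` (stated via the `p`-th powers). -/
theorem stmt9 (d N : ℕ) (hN : 1 ≤ N) (p : ℝ) (hp : p = 2 / N)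
    (a : (Fin d → ℤ) → (Fin d → ℤ) → ℂ)
    (ha : Summable (fun jk : (Fin d → ℤ) × (Fin d → ℤ) => ‖a jk.1 jk.2‖ ^ p)) :
    ∃ T : lp (fun _ : Fin d → ℤ => ℂ) 2 →L[ℂ] lp (fun _ : Fin d → ℤ => ℂ) 2,
      (∀ f : lp (fun _ : Fin d → ℤ => ℂ) 2, ∀ j,
        (T f : (Fin d → ℤ) → ℂ) j = ∑' k, a j k * (f : (Fin d → ℤ) → ℂ) k) ∧
      Summable (fun n => singVal T n ^ p) ∧
      (∑' n, singVal T n ^ p) ≤ ∑' jk : (Fin d → ℤ) × (Fin d → ℤ), ‖a jk.1 jk.2‖ ^ p := by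
  have hN' : (1 : ℝ) ≤ N := by exact_mod_cast hN
  have hp0 : 0 < p := by rw [hp]; positivity
  have hp2 : p ≤ 2 := by rw [hp]; exact div_le_self zero_le_two hN'
  obtain ⟨T, hT, -⟩ := exists_clm_of_summable_norm_sq a
    (summable_sq_and_tsum_sq_le (fun jk : (Fin d → ℤ) × (Fin d → ℤ) =>
      norm_nonneg (a jk.1 jk.2)) hp0 hp2 ha).1
  exact ⟨T, hT, summable_singVal_rpow_and_tsum_le hp0 hp2 ha hT⟩
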